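/- arXiv:2505.05770 — 2 statements merged into one kernel-verified Lean document; each statement's English description precedes it below -/
import Mathlib

section
/- Assume {W_ε} is L-admissible and β ∈ Γ. Then there exists γ_k > 0 such that for every 0 < ε < γ_k the N×N matrix P_{ε,β} = D_{k,β,L} W_ε has N pairwise distinct eigenvalues. -/
noncomputable section
open Complex Filter Topology MeasureTheory

/-- `eC k b = exp(-2πi k b)`. -/
def eC (k : ℤ) (b : ℝ) : ℂ := Complex.exp (-2 * (Real.pi : ℂ) * Complex.I * (k : ℂ) * (b : ℂ))

variable {N S : ℕ}

/-- Hermitian inner product `⟨v,w⟩ = ∑_j v j * conj (w j)` on `ℂ^N`. -/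
def inn (v w : Fin N → ℂ) : ℂ := ∑ j, v j * (starRingEnd ℂ) (w j)

/-- Euclidean norm on `ℂ^N`. -/
def nrm (v : Fin N → ℂ) : ℝ := Real.sqrt (∑ j, Complex.normSq (v j))

/-- `W_ε = I + ε Ẇ` (complexified). -/
def Weps (Wd : Matrix (Fin N) (Fin N) ℝ) (ε : ℝ) : Matrix (Fin N) (Fin N) ℂ :=
  1 + (ε : ℂ) • (Wd.map Complex.ofReal)

/-- The diagonal matrix `D_{k,α}` with entries `exp(-2πik α_j)`. -/
def DmatA (k : ℤ) (α : Fin N → ℝ) : Matrix (Fin N) (Fin N) ℂ :=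
  Matrix.diagonal fun j => eC k (α j)

/-- Partial sums of the band-width vector: `Nsum L s = L 0 + ⋯ + L (s-1)`. -/
def Nsum (L : Fin S → ℕ) (s : ℕ) : ℕ := ∑ i : Fin S, if (i : ℕ) < s then L i else 0

/-- `j` belongs to the `s`-th band `B_s` (with `j` 0-indexed). -/
def inBand (L : Fin S → ℕ) (s : Fin S) (j : Fin N) : Prop :=
  Nsum L (s : ℕ) ≤ (j : ℕ) ∧ (j : ℕ) < Nsum L ((s : ℕ) + 1)

/-- `D_{k,β,L}`: block-diagonal with `s`-th block `exp(-2πik β_s)·Id`, expressed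
via the band-index function `bI` (where `bI j` is the band of `j`). -/
def Dmat (k : ℤ) (β : Fin S → ℝ) (bI : Fin N → Fin S) : Matrix (Fin N) (Fin N) ℂ :=
  Matrix.diagonal fun j => eC k (β (bI j))

/-- `P_{ε,β} = D_{k,β,L} W_ε`. -/
def Pmat (k : ℤ) (β : Fin S → ℝ) (bI : Fin N → Fin S) (Wd : Matrix (Fin N) (Fin N) ℝ)
    (ε : ℝ) : Matrix (Fin N) (Fin N) ℂ := Dmat k β bI * Weps Wd ε

/-- `Ŵ_L`: the block-diagonal part of `Ẇ` (blocks `Ŵ_1, …, Ŵ_S`). -/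
def WhatL (Wd : Matrix (Fin N) (Fin N) ℝ) (bI : Fin N → Fin S) : Matrix (Fin N) (Fin N) ℝ :=
  Matrix.of fun j l => if bI j = bI l then Wd j l else 0

/-- `P̂_{k,β,L} = D_{k,β,L} Ŵ_L`. -/
def Phat (k : ℤ) (β : Fin S → ℝ) (bI : Fin N → Fin S) (Wd : Matrix (Fin N) (Fin N) ℝ) :
    Matrix (Fin N) (Fin N) ℂ := Dmat k β bI * (WhatL Wd bI).map Complex.ofReal

/-- `L`-admissibility of the family `W_ε = I + εẆ`. -/
def LAdmissible (L : Fin S → ℕ) (Wd : Matrix (Fin N) (Fin N) ℝ) (bI : Fin N → Fin S) : Prop :=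
  Wd.IsSymm ∧ (∀ i j, i ≠ j → 0 ≤ Wd i j) ∧ (∀ i, ∑ j, Wd i j = 0) ∧
  (∃ μ : Fin N → ℝ, Function.Injective μ ∧ ∃ v : Fin N → Fin N → ℝ,
    (∀ i, v i ≠ 0) ∧ ∀ i, Wd.mulVec (v i) = μ i • v i) ∧
  (∀ s : Fin S, ∃ μ : Fin (L s) → ℝ, Function.Injective μ ∧
    ∃ v : Fin (L s) → Fin N → ℝ, (∀ i, v i ≠ 0) ∧ (∀ i j, bI j ≠ s → v i j = 0) ∧
      ∀ i, (WhatL Wd bI).mulVec (v i) = μ i • v i)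

/-- `β ∈ Γ`: for every nonzero integer `k'`, the exponentials `exp(-2πik' β_s)`
of distinct bands never coincide. -/
def Gamma (β : Fin S → ℝ) : Prop :=
  ∀ k' : ℤ, k' ≠ 0 → ∀ s1 s2 : Fin S, s1 ≠ s2 → eC k' (β s1) ≠ eC k' (β s2)

/-- Orthogonal projection `π_s` of `ℂ^N` onto `V_s`. -/
def projBand (bI : Fin N → Fin S) (s : Fin S) (v : Fin N → ℂ) : Fin N → ℂ :=
  fun j => if bI j = s then v j else 0

/-- `min_{θ∈[0,2π)} ‖v − e^{iθ} w‖`. -/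
def phaseDist (v w : Fin N → ℂ) : ℝ :=
  sInf ((fun θ : ℝ => nrm (v - Complex.exp (θ * Complex.I) • w)) '' Set.Ico 0 (2 * Real.pi))

/-- `dist_{ℂP}(v,w) = min_{θ∈[0,2π)} ‖v/‖v‖ − e^{iθ}·w/‖w‖‖`. -/
def cpDist (v w : Fin N → ℂ) : ℝ :=
  sInf ((fun θ : ℝ =>
    nrm ((nrm v)⁻¹ • v - Complex.exp (θ * Complex.I) • ((nrm w)⁻¹ • w))) '' Set.Ico 0 (2 * Real.pi))

/-- Hurwitz-type stability: an isolated zero of `f 0` persists under a continuous perturbation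
through entire functions. -/
lemma eventually_exists_zero_mem_closedBall {f : ℝ → ℂ → ℂ}
    (hf : Continuous fun p : ℝ × ℂ => f p.1 p.2) (hd : ∀ ε, Differentiable ℂ (f ε)) {x₀ : ℂ}
    (h0 : f 0 x₀ = 0) (hne : ∀ᶠ x in 𝓝[≠] x₀, f 0 x ≠ 0) {r : ℝ} (hr : 0 < r) :
    ∀ᶠ ε in 𝓝 (0 : ℝ), ∃ x ∈ Metric.closedBall x₀ r, f ε x = 0 := by
  rw [eventually_nhdsWithin_iff, Metric.eventually_nhds_iff] at hne
  obtain ⟨δ, hδ, hne⟩ := hne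
  obtain ⟨ρ, hρ0, hρ⟩ := exists_between (lt_min hr hδ)
  have hsph : ∀ x ∈ Metric.sphere x₀ ρ, f 0 x ≠ 0 := by
    intro x hx
    rw [Metric.mem_sphere] at hx
    refine hne (by rw [hx]; exact hρ.trans_le (min_le_right _ _)) ?_
    rintro rfl
    simp at hx
    exact hρ0.ne hx
  have hcomp : IsCompact (Metric.sphere x₀ ρ) := isCompact_sphere x₀ ρ
  have hnonempty : (Metric.sphere x₀ ρ).Nonempty := NormedSpace.sphere_nonempty.2 hρ0.le
  have hf0 : Continuous (f 0) := (hd 0).continuous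
  obtain ⟨y, hy, hmin⟩ := hcomp.exists_isMinOn hnonempty hf0.norm.continuousOn
  have hc : 0 < ‖f 0 y‖ := norm_pos_iff.2 (hsph y hy)
  set c := ‖f 0 y‖
  have h1 : ∀ᶠ ε in 𝓝 (0 : ℝ), ∀ x ∈ Metric.sphere x₀ ρ, c / 2 < ‖f ε x - f ε x₀‖ := by
    refine hcomp.eventually_forall_of_forall_eventually fun x hx => ?_
    have hcont : Continuous fun p : ℝ × ℂ => ‖f p.1 p.2 - f p.1 x₀‖ :=
      (hf.sub (hf.comp (continuous_fst.prodMk continuous_const))).norm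
    refine hcont.continuousAt.eventually_const_lt ?_
    have : c ≤ ‖f 0 x‖ := hmin hx
    simp only [h0, sub_zero]
    linarith
  have h2 : ∀ᶠ ε in 𝓝 (0 : ℝ), ‖f ε x₀‖ < c / 2 / 2 := by
    have hcont : Continuous fun ε : ℝ => ‖f ε x₀‖ :=
      (hf.comp (continuous_id.prodMk continuous_const)).norm
    refine hcont.continuousAt.eventually_lt_const ?_
    simp only [h0, norm_zero]
    linarith
  filter_upwards [h1, h2] with ε h1 h2
  have hfreq : ∃ᶠ z in 𝓝 x₀, f ε z ≠ f ε x₀ := by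
    intro hev
    have hconst : f ε = fun _ => f ε x₀ := by
      refine AnalyticOnNhd.eq_of_eventuallyEq (z₀ := x₀)
        (fun z _ => (hd ε).analyticAt z) (fun z _ => analyticAt_const) ?_
      filter_upwards [hev] with z hz
      simpa using hz
    have := h1 y hy
    rw [congrFun hconst y, sub_self, norm_zero] at this
    linarith
  obtain ⟨x, hx, hx0⟩ := (hd ε).diffContOnCl.ball_subset_image_closedBall hρ0
    (fun z hz => (h1 z hz).le) hfreq
    (show (0 : ℂ) ∈ Metric.ball (f ε x₀) (c / 2 / 2) by simpa using h2)
  exact ⟨x, Metric.closedBall_subset_closedBall (hρ.le.trans (min_le_left _ _)) hx, hx0⟩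

section Blowup

variable {n T ι : Type*} [Fintype n] [DecidableEq n] [DecidableEq T]

lemma isRoot_charpoly_of_mulVec_eq_smul {A : Matrix n n ℂ} {v : n → ℂ} {z : ℂ} (hv : v ≠ 0)
    (h : A.mulVec v = z • v) : A.charpoly.IsRoot z := by
  rw [Polynomial.IsRoot, Matrix.eval_charpoly]
  refine Matrix.exists_mulVec_eq_zero_iff.1 ⟨v, hv, ?_⟩
  rw [Matrix.sub_mulVec, h, Matrix.scalar_apply, ← Matrix.smul_one_eq_diagonal,
    Matrix.smul_mulVec, Matrix.one_mulVec, sub_self]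

/-- The matrix `z - D (1 + ε W)` at `z = d s * (1 + ε x)`, where `D` is diagonal with entries
`d (b j)`, with the rows of the band `s` divided by `ε`. -/
def blowup (b : n → T) (d : T → ℂ) (W : Matrix n n ℂ) (s : T) (ε x : ℂ) : Matrix n n ℂ :=
  Matrix.of fun j l =>
    if b j = s then d s * (x * (1 : Matrix n n ℂ) j l - W j l)
    else (d s * (1 + ε * x) - d (b j)) * (1 : Matrix n n ℂ) j l - ε * d (b j) * W j l

lemma blowup_mulVec (b : n → T) (d : T → ℂ) (W : Matrix n n ℂ) (s : T) (ε x : ℂ) (v : n → ℂ)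
    (j : n) : (blowup b d W s ε x).mulVec v j =
      if b j = s then d s * (x * v j - W.mulVec v j)
      else (d s * (1 + ε * x) - d (b j)) * v j - ε * d (b j) * W.mulVec v j := by
  have h1 : ∑ l, (1 : Matrix n n ℂ) j l * v l = v j := congrFun (Matrix.one_mulVec v) j
  simp only [Matrix.mulVec, dotProduct, blowup, Matrix.of_apply]
  split_ifs
  · conv_rhs => rw [← h1]
    rw [Finset.mul_sum, ← Finset.sum_sub_distrib, Finset.mul_sum]
    exact Finset.sum_congr rfl fun l _ => by ring
  · conv_rhs => rw [← h1]
    rw [Finset.mul_sum, Finset.mul_sum, ← Finset.sum_sub_distrib]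
    exact Finset.sum_congr rfl fun l _ => by ring

lemma isRoot_charpoly_of_det_blowup_eq_zero {b : n → T} {d : T → ℂ} (hd0 : ∀ t, d t ≠ 0)
    {W : Matrix n n ℂ} {s : T} {ε x : ℂ} (h : (blowup b d W s ε x).det = 0) :
    (Matrix.diagonal (fun j => d (b j)) * (1 + ε • W)).charpoly.IsRoot (d s * (1 + ε * x)) := by
  obtain ⟨v, hv, hMv⟩ := Matrix.exists_mulVec_eq_zero_iff.2 h
  refine isRoot_charpoly_of_mulVec_eq_smul hv ?_
  ext j
  have hj := congrFun hMv j
  rw [blowup_mulVec] at hj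
  rw [← Matrix.mulVec_mulVec, Matrix.mulVec_diagonal, Matrix.add_mulVec, Matrix.one_mulVec,
    Matrix.smul_mulVec]
  simp only [Pi.add_apply, Pi.smul_apply, smul_eq_mul, Pi.zero_apply] at hj ⊢
  split_ifs at hj with hb
  · have := (mul_eq_zero.1 hj).resolve_left (hd0 s)
    rw [hb]
    linear_combination (-ε * d s) * this
  · linear_combination -hj

lemma det_blowup_zero_eq_zero {b : n → T} {d : T → ℂ} {W : Matrix n n ℂ} {s : T} {μ : ℂ}
    {v : n → ℂ} (hv : v ≠ 0) (hsupp : ∀ j, b j ≠ s → v j = 0)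
    (heig : ∀ j, b j = s → W.mulVec v j = μ * v j) : (blowup b d W s 0 μ).det = 0 := by
  refine Matrix.exists_mulVec_eq_zero_iff.1 ⟨v, hv, ?_⟩
  ext j
  rw [blowup_mulVec]
  split_ifs with hb
  · simp [heig j hb]
  · simp [hsupp j hb]

lemma eventually_det_blowup_zero_ne_zero {b : n → T} {d : T → ℂ} (hd0 : ∀ t, d t ≠ 0)
    (hd : Function.Injective d) (W : Matrix n n ℂ) (s : T) (x₀ : ℂ) :
    ∀ᶠ x in 𝓝[≠] x₀, (blowup b d W s 0 x).det ≠ 0 := by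
  set A : Matrix n n ℂ := Matrix.of fun j l => if b j = s then W j l else 0
  have hfin : {x | (blowup b d W s 0 x).det = 0}.Finite := by
    refine (A.charpoly.roots.toFinset.finite_toSet).subset fun x hx => ?_
    obtain ⟨v, hv, hMv⟩ := Matrix.exists_mulVec_eq_zero_iff.2 hx
    suffices A.charpoly.IsRoot x by
      simpa [Polynomial.mem_roots A.charpoly_monic.ne_zero] using this
    refine isRoot_charpoly_of_mulVec_eq_smul hv ?_
    ext j
    have hj := congrFun hMv j
    rw [blowup_mulVec] at hj
    simp only [Pi.smul_apply, smul_eq_mul, Pi.zero_apply] at hj ⊢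
    split_ifs at hj with hb
    · have := (mul_eq_zero.1 hj).resolve_left (hd0 s)
      have hA : A.mulVec v j = W.mulVec v j := by simp [A, Matrix.mulVec, dotProduct, hb]
      rw [hA]
      linear_combination -this
    · have hA : A.mulVec v j = 0 := by simp [A, Matrix.mulVec, dotProduct, hb]
      have hsub : d s - d (b j) ≠ 0 := sub_ne_zero.2 fun h => hb (hd h).symm
      have hvj : v j = 0 := by simpa [hsub] using hj
      rw [hA, hvj, mul_zero]
  have hev : ∀ᶠ x in 𝓝[≠] x₀, x ∉ {x | (blowup b d W s 0 x).det = 0} := by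
    have h := (hfin.subset (Set.sdiff_subset (t := {x₀}))).isClosed.isOpen_compl.mem_nhds
      (show x₀ ∈ ({x | (blowup b d W s 0 x).det = 0} \ {x₀})ᶜ by simp)
    rw [eventually_nhdsWithin_iff]
    filter_upwards [h] with x hx hne hx0
    exact hx ⟨hx0, hne⟩
  exact hev

lemma continuous_det_blowup (b : n → T) (d : T → ℂ) (W : Matrix n n ℂ) (s : T) :
    Continuous fun p : ℝ × ℂ => (blowup b d W s p.1 p.2).det := by
  refine Continuous.matrix_det (continuous_matrix fun j l => ?_)
  simp only [blowup, Matrix.of_apply]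
  split_ifs <;> fun_prop

lemma differentiable_det_blowup (b : n → T) (d : T → ℂ) (W : Matrix n n ℂ) (s : T) (ε : ℂ) :
    Differentiable ℂ fun x => (blowup b d W s ε x).det := by
  simp only [Matrix.det_apply]
  refine Differentiable.fun_sum fun σ _ => Differentiable.const_smul ?_ _
  refine Differentiable.fun_finsetProd fun j _ => ?_
  simp only [blowup, Matrix.of_apply]
  split_ifs <;> fun_prop

lemma nodup_roots_of_injective_isRoot {p : Polynomial ℂ} [Fintype ι] (hp : p ≠ 0)
    (hdeg : p.natDegree = Fintype.card ι) {z : ι → ℂ} (hz : Function.Injective z)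
    (hroot : ∀ i, p.IsRoot (z i)) :
    p.roots.Nodup ∧ Multiset.card p.roots = Fintype.card ι := by
  classical
  have h1 : Fintype.card ι ≤ p.roots.toFinset.card := by
    rw [← Finset.card_univ, ← Finset.card_image_of_injective _ hz]
    refine Finset.card_le_card fun y hy => ?_
    obtain ⟨i, -, rfl⟩ := Finset.mem_image.1 hy
    simpa [Polynomial.mem_roots hp] using hroot i
  have h2 := p.roots.toFinset_card_le
  have h3 : Multiset.card p.roots ≤ Fintype.card ι := hdeg ▸ p.card_roots'
  exact ⟨Multiset.toFinset_card_eq_card_iff_nodup.1 (by lia), by lia⟩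

/-- If `d` is injective and every diagonal block of `W` has simple spectrum, then
`D (1 + ε W)` has simple spectrum for small `ε > 0`. -/
theorem eventually_nodup_roots_charpoly [Fintype ι] (hcard : Fintype.card ι = Fintype.card n)
    {b : n → T} {d : T → ℂ} (hd0 : ∀ t, d t ≠ 0) (hd : Function.Injective d)
    {W : Matrix n n ℂ} {s : ι → T} {μ : ι → ℂ}
    (hinj : ∀ i j, s i = s j → μ i = μ j → i = j) {v : ι → n → ℂ} (hv : ∀ i, v i ≠ 0)
    (hsupp : ∀ i j, b j ≠ s i → v i j = 0)
    (heig : ∀ i j, b j = s i → W.mulVec (v i) j = μ i * v i j) :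
    ∀ᶠ ε : ℝ in 𝓝[>] 0,
      (Matrix.diagonal (fun j => d (b j)) * (1 + (ε : ℂ) • W)).charpoly.roots.Nodup ∧
      Multiset.card (Matrix.diagonal (fun j => d (b j)) * (1 + (ε : ℂ) • W)).charpoly.roots
        = Fintype.card n := by
  obtain ⟨r, hr, hr0⟩ : ∃ r : ℝ, (∀ i j, μ i ≠ μ j → r + r < dist (μ i) (μ j)) ∧ 0 < r := by
    have : ∀ᶠ r in 𝓝[>] (0 : ℝ), ∀ i j, μ i ≠ μ j → r + r < dist (μ i) (μ j) := by
      refine eventually_all.2 fun i => eventually_all.2 fun j => ?_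
      by_cases h : μ i = μ j
      · simp [h]
      have hc : Continuous fun r : ℝ => r + r := by fun_prop
      have := (hc.continuousAt (x := 0)).eventually_lt_const
        (show (0 : ℝ) + 0 < dist (μ i) (μ j) by simpa using h)
      filter_upwards [nhdsWithin_le_nhds this] with r hr _ using hr
    exact (this.and self_mem_nhdsWithin).exists
  have hzero : ∀ᶠ ε : ℝ in 𝓝 0, ∀ i, ∃ x ∈ Metric.closedBall (μ i) r,
      (blowup b d W (s i) ε x).det = 0 := by
    refine eventually_all.2 fun i => ?_
    refine eventually_exists_zero_mem_closedBall (continuous_det_blowup b d W (s i))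
      (fun ε => differentiable_det_blowup b d W (s i) ε) ?_ ?_ hr0
    · rw [ofReal_zero]
      exact det_blowup_zero_eq_zero (hv i) (hsupp i) (heig i)
    · rw [ofReal_zero]
      exact eventually_det_blowup_zero_ne_zero hd0 hd W (s i) (μ i)
  have hsep : ∀ᶠ ε : ℝ in 𝓝 0, ∀ i j, s i ≠ s j →
      ∀ p ∈ Metric.closedBall (μ i) r ×ˢ Metric.closedBall (μ j) r,
        d (s i) * (1 + ε * p.1) ≠ d (s j) * (1 + ε * p.2) := by
    refine eventually_all.2 fun i => eventually_all.2 fun j => ?_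
    by_cases h : s i = s j
    · simp [h]
    suffices ∀ᶠ ε : ℝ in 𝓝 0,
        ∀ p ∈ Metric.closedBall (μ i) r ×ˢ Metric.closedBall (μ j) r,
          d (s i) * (1 + ε * p.1) ≠ d (s j) * (1 + ε * p.2) by
      filter_upwards [this] with ε hε _ using hε
    refine ((isCompact_closedBall _ _).prod
      (isCompact_closedBall _ _)).eventually_forall_of_forall_eventually fun p _ => ?_
    have hopen : IsOpen {q : ℝ × ℂ × ℂ |
        d (s i) * (1 + q.1 * q.2.1) ≠ d (s j) * (1 + q.1 * q.2.2)} :=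
      isOpen_ne_fun (by fun_prop) (by fun_prop)
    exact hopen.mem_nhds (by simpa using fun h' => h (hd h'))
  filter_upwards [nhdsWithin_le_nhds hzero, nhdsWithin_le_nhds hsep, self_mem_nhdsWithin]
    with ε hzero hsep hε
  choose x hx hx0 using hzero
  rw [← hcard]
  refine nodup_roots_of_injective_isRoot (Matrix.charpoly_monic _).ne_zero
    (by rw [Matrix.charpoly_natDegree_eq_dim, hcard]) (z := fun i => d (s i) * (1 + ε * x i)) ?_
    fun i => isRoot_charpoly_of_det_blowup_eq_zero hd0 (hx0 i)
  intro i j hij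
  by_cases hs : s i = s j
  · refine hinj i j hs ?_
    by_contra hμ
    have hε0 : (ε : ℂ) ≠ 0 := ofReal_ne_zero.2 (ne_of_gt hε)
    simp only [hs] at hij
    have hxx : x i = x j := mul_left_cancel₀ hε0 (add_left_cancel (mul_left_cancel₀ (hd0 _) hij))
    have h1 := hr i j hμ
    have h2 := dist_triangle_left (μ i) (μ j) (x i)
    have h3 := Metric.mem_closedBall.1 (hx i)
    have h4 := Metric.mem_closedBall.1 (hx j)
    rw [← hxx] at h4
    linarith
  · exact absurd hij (hsep i j hs (x i, x j) ⟨hx i, hx j⟩)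

end Blowup

lemma mulVec_map_ofReal {N : ℕ} (W : Matrix (Fin N) (Fin N) ℝ) (v : Fin N → ℝ) (j : Fin N) :
    (W.map Complex.ofReal).mulVec (fun l => (v l : ℂ)) j = (W.mulVec v j : ℂ) := by
  simp [Matrix.mulVec, dotProduct]

lemma WhatL_mulVec_eq {N S : ℕ} {Wd : Matrix (Fin N) (Fin N) ℝ} {bI : Fin N → Fin S} {s : Fin S}
    {v : Fin N → ℝ} (hsupp : ∀ j, bI j ≠ s → v j = 0) {j : Fin N} (hj : bI j = s) :
    (WhatL Wd bI).mulVec v j = Wd.mulVec v j := by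
  simp only [Matrix.mulVec, dotProduct, WhatL, Matrix.of_apply]
  refine Finset.sum_congr rfl fun l _ => ?_
  by_cases hl : bI l = s
  · rw [if_pos (hj.trans hl.symm)]
  · simp [hsupp l hl]

/-- for `β ∈ Γ` and an `L`-admissible family, `P_{ε,β}` has `N`
pairwise distinct eigenvalues for all sufficiently small `ε > 0`. -/
theorem stmt3 (N S : ℕ) (hN : 1 ≤ N) (hS1 : 1 ≤ S) (hSN : S ≤ N) (k : ℤ)
    (β : Fin S → ℝ) (hβ : Function.Injective β)
    (L : Fin S → ℕ) (hL : ∀ s, 0 < L s) (hsum : ∑ s, L s = N)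
    (bI : Fin N → Fin S) (hbI : ∀ j, inBand L (bI j) j)
    (Wd : Matrix (Fin N) (Fin N) ℝ) (hadm : LAdmissible L Wd bI)
    (hΓ : Gamma β) :
    ∃ γk : ℝ, 0 < γk ∧ ∀ ε : ℝ, 0 < ε → ε < γk →
      (Matrix.charpoly (Pmat k β bI Wd ε)).roots.Nodup ∧
      Multiset.card (Matrix.charpoly (Pmat k β bI Wd ε)).roots = N := by
  obtain ⟨-, -, -, ⟨μ₀, hμ₀, v₀, hv₀, he₀⟩, hblock⟩ := hadm
  suffices h : ∀ᶠ ε : ℝ in 𝓝[>] 0, (Matrix.charpoly (Pmat k β bI Wd ε)).roots.Nodup ∧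
      Multiset.card (Matrix.charpoly (Pmat k β bI Wd ε)).roots = N by
    obtain ⟨γ, hγ, hsub⟩ := mem_nhdsGT_iff_exists_Ioo_subset.1 h
    exact ⟨γ, hγ, fun ε h0 h1 => hsub ⟨h0, h1⟩⟩
  by_cases hk : k = 0
  · subst hk
    have h := eventually_nodup_roots_charpoly (ι := Fin N) (b := fun _ : Fin N => ())
      (d := fun _ => (1 : ℂ)) (W := Wd.map Complex.ofReal) (s := fun _ => ())
      (μ := fun i => (μ₀ i : ℂ)) (v := fun i j => (v₀ i j : ℂ)) rfl (fun _ => one_ne_zero)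
      (Function.injective_of_subsingleton _)
      (fun i j _ hij => hμ₀ (ofReal_injective hij))
      (fun i hi => hv₀ i (funext fun j => ofReal_injective (congrFun hi j)))
      (fun i j hij => absurd rfl hij)
      (fun i j _ => by rw [mulVec_map_ofReal, he₀ i]; simp)
    simpa [Pmat, Dmat, Weps, eC] using h
  · choose μ hμ v hv hsupp he using hblock
    have h := eventually_nodup_roots_charpoly (ι := Σ s, Fin (L s)) (b := bI)
      (d := fun s => eC k (β s)) (W := Wd.map Complex.ofReal) (s := fun i => i.1)
      (μ := fun i => (μ i.1 i.2 : ℂ)) (v := fun i j => (v i.1 i.2 j : ℂ)) (by simp [hsum])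
      (fun _ => Complex.exp_ne_zero _)
      (fun s t hst => by
        by_contra hne
        exact hΓ k hk s t hne hst)
      (by
        rintro ⟨s, i⟩ ⟨t, j⟩ (rfl : s = t) hij
        exact congrArg (Sigma.mk s) (hμ s (ofReal_injective hij)))
      (fun i hi => hv i.1 i.2 (funext fun j => ofReal_injective (congrFun hi j)))
      (fun i j hij => by rw [hsupp i.1 i.2 j hij, ofReal_zero])
      (fun i j hij => by
        rw [mulVec_map_ofReal, ← WhatL_mulVec_eq (hsupp i.1 i.2) hij, he i.1 i.2]
        simp)
    simpa [Pmat, Dmat, Weps] using h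
end
end

section
/- Assume {W_ε} is L-admissible and the numbers e^{−2πikβ_1},…,e^{−2πikβ_S} are pairwise distinct. For each sufficiently small ε > 0 let {f_ε^{(1)},…,f_ε^{(N)}} be a basis of ℂ^N of unit-norm eigenvectors of P_{ε,β}, with P_{ε,β} f_ε^{(ℓ)} = λ_ε^{(ℓ)} f_ε^{(ℓ)}, labelled so that λ_ε^{(ℓ)} → e^{−2πikβ_{s_ℓ}} as ε → 0 for each ℓ. Then for all ℓ ≠ m in {1,…,N}, ⟨f_ε^{(ℓ)}, f_ε^{(m)}⟩ → 0 as ε → 0. -/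
noncomputable section
open Complex Filter Topology MeasureTheory

variable {N S : ℕ}

lemma nrm_eq_zero_iff (v : Fin N → ℂ) : nrm v = 0 ↔ v = 0 := by
  unfold nrm
  rw [Real.sqrt_eq_zero (Finset.sum_nonneg fun j _ => Complex.normSq_nonneg _),
    Finset.sum_eq_zero_iff_of_nonneg fun j _ => Complex.normSq_nonneg _]
  simp [funext_iff]

lemma nrm_zero : nrm (0 : Fin N → ℂ) = 0 := (nrm_eq_zero_iff 0).2 rfl

lemma nrm_smul (c : ℂ) (v : Fin N → ℂ) : nrm (c • v) = ‖c‖ * nrm v := by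
  unfold nrm
  simp only [Pi.smul_apply, smul_eq_mul, Complex.normSq_mul, ← Finset.mul_sum]
  rw [Real.sqrt_mul (Complex.normSq_nonneg _)]
  rfl

lemma continuous_nrm : Continuous (nrm : (Fin N → ℂ) → ℝ) := by
  unfold nrm
  have := Complex.continuous_normSq
  fun_prop

lemma norm_le_nrm (v : Fin N → ℂ) : ‖v‖ ≤ nrm v := by
  refine (pi_norm_le_iff_of_nonneg (Real.sqrt_nonneg _)).2 fun j => ?_
  refine Real.sqrt_le_sqrt ?_
  exact Finset.single_le_sum (f := fun j => Complex.normSq (v j))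
    (fun j _ => Complex.normSq_nonneg _) (Finset.mem_univ j)

lemma inn_self (v : Fin N → ℂ) : inn v v = ((nrm v ^ 2 : ℝ) : ℂ) := by
  unfold inn nrm
  rw [Real.sq_sqrt (Finset.sum_nonneg fun j _ => Complex.normSq_nonneg _)]
  simp [Complex.mul_conj]

lemma inn_sub_left (u v w : Fin N → ℂ) : inn (u - v) w = inn u w - inn v w := by
  simp [inn, sub_mul, Finset.sum_sub_distrib]

lemma inn_smul_left (c : ℂ) (v w : Fin N → ℂ) : inn (c • v) w = c * inn v w := by
  simp [inn, Finset.mul_sum, mul_assoc]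

lemma inn_smul_right (c : ℂ) (v w : Fin N → ℂ) :
    inn v (c • w) = (starRingEnd ℂ) c * inn v w := by
  simp only [inn, Finset.mul_sum, Pi.smul_apply, smul_eq_mul, map_mul]
  exact Finset.sum_congr rfl fun j _ => by ring

lemma tendsto_inn {ι : Type*} {F : Filter ι} {f g : ι → Fin N → ℂ} {u w : Fin N → ℂ}
    (hf : Tendsto f F (𝓝 u)) (hg : Tendsto g F (𝓝 w)) :
    Tendsto (fun ε => inn (f ε) (g ε)) F (𝓝 (inn u w)) := by
  rw [tendsto_pi_nhds] at hf hg
  exact tendsto_finsetSum _ fun j _ =>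
    (hf j).mul ((Complex.continuous_conj.tendsto _).comp (hg j))

/-- Unit vectors converge along every ultrafilter. -/
lemma exists_tendsto_of_nrm_eq_one {ι : Type*} (F : Ultrafilter ι) (f : ι → Fin N → ℂ)
    (hf : ∀ᶠ ε in (F : Filter ι), nrm (f ε) = 1) :
    ∃ u, nrm u = 1 ∧ Tendsto f F (𝓝 u) := by
  have hc : IsCompact {v : Fin N → ℂ | nrm v = 1} := by
    refine (isCompact_closedBall (0 : Fin N → ℂ) 1).of_isClosed_subset
      (isClosed_eq continuous_nrm continuous_const) fun v hv => ?_
    rw [mem_closedBall_zero_iff]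
    exact (norm_le_nrm v).trans hv.le
  obtain ⟨u, hu, hle⟩ := hc.ultrafilter_le_nhds (F.map f) (le_principal_iff.2 hf)
  exact ⟨u, hu, hle⟩

/-- Two linearly independent vectors yield a unit combination orthogonal to the first. -/
lemma exists_unit_combination_orthogonal {u w : Fin N → ℂ} (hu : nrm u = 1)
    (huw : ∀ c : ℂ, w ≠ c • u) :
    ∃ a b : ℂ, nrm (a • w - b • u) = 1 ∧ inn (a • w - b • u) u = 0 := by
  set g := w - inn w u • u with hg
  have hg0 : nrm g ≠ 0 := fun h => huw _ (sub_eq_zero.1 ((nrm_eq_zero_iff g).1 h))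
  have hgu : inn g u = 0 := by simp [hg, inn_sub_left, inn_smul_left, inn_self, hu]
  obtain ⟨t, ht⟩ : ∃ t : ℂ, t = ((nrm g)⁻¹ : ℝ) := ⟨_, rfl⟩
  have key : t • w - (t * inn w u) • u = t • g := by
    rw [hg, smul_sub, smul_smul]
  refine ⟨t, t * inn w u, ?_, ?_⟩
  · have : 0 ≤ (nrm g)⁻¹ := inv_nonneg.2 (Real.sqrt_nonneg _)
    rw [key, nrm_smul, ht, Complex.norm_real, Real.norm_of_nonneg this, inv_mul_cancel₀ hg0]
  · rw [key, inn_smul_left, hgu, mul_zero]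

lemma eC_ne_zero (k : ℤ) (b : ℝ) : eC k b ≠ 0 := Complex.exp_ne_zero _

lemma Pmat_mulVec_apply (k : ℤ) (β : Fin S → ℝ) (bI : Fin N → Fin S)
    (Wd : Matrix (Fin N) (Fin N) ℝ) (ε : ℝ) (v : Fin N → ℂ) (j : Fin N) :
    (Pmat k β bI Wd ε).mulVec v j
      = eC k (β (bI j)) * (v j + ε * (Wd.map Complex.ofReal).mulVec v j) := by
  rw [Pmat, Dmat, Weps, ← Matrix.mulVec_mulVec, Matrix.mulVec_diagonal, Matrix.add_mulVec,
    Matrix.one_mulVec, Matrix.smul_mulVec]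
  rfl

lemma WhatL_mulVec_apply {Wd : Matrix (Fin N) (Fin N) ℝ} {bI : Fin N → Fin S} {s : Fin S}
    {v : Fin N → ℂ} (hv : ∀ j, bI j ≠ s → v j = 0) {j : Fin N} (hj : bI j = s) :
    ((WhatL Wd bI).map Complex.ofReal).mulVec v j = (Wd.map Complex.ofReal).mulVec v j := by
  simp only [Matrix.mulVec, dotProduct]
  refine Finset.sum_congr rfl fun l _ => ?_
  by_cases hl : bI l = s
  · simp [WhatL, hl, hj]
  · simp [hv l hl]

lemma WhatL_mulVec_apply_of_ne {Wd : Matrix (Fin N) (Fin N) ℝ} {bI : Fin N → Fin S} {s : Fin S}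
    {v : Fin N → ℂ} (hv : ∀ j, bI j ≠ s → v j = 0) {j : Fin N} (hj : bI j ≠ s) :
    ((WhatL Wd bI).map Complex.ofReal).mulVec v j = 0 := by
  simp only [Matrix.mulVec, dotProduct]
  refine Finset.sum_eq_zero fun l _ => ?_
  by_cases hl : bI l = s
  · have : bI j ≠ bI l := by rwa [hl]
    simp [WhatL, this]
  · simp [hv l hl]

/-- Eigenvectors of `P_{ε,β}` for distinct eigenvalues are orthogonal for the bilinear form
with matrix `D⁻¹`. -/
lemma sum_inv_mul_mul_eq_zero {k : ℤ} {β : Fin S → ℝ} {bI : Fin N → Fin S}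
    {Wd : Matrix (Fin N) (Fin N) ℝ} (hW : Wd.IsSymm) {ε : ℝ} {v w : Fin N → ℂ} {a b : ℂ}
    (hv : (Pmat k β bI Wd ε).mulVec v = a • v) (hw : (Pmat k β bI Wd ε).mulVec w = b • w)
    (hab : a ≠ b) : ∑ j, (eC k (β (bI j)))⁻¹ * (v j * w j) = 0 := by
  have key : ∀ {x y : Fin N → ℂ} {c : ℂ}, (Pmat k β bI Wd ε).mulVec x = c • x →
      c * ∑ j, (eC k (β (bI j)))⁻¹ * (x j * y j)
        = y ⬝ᵥ x + ε * (y ⬝ᵥ (Wd.map Complex.ofReal).mulVec x) := by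
    intro x y c hx
    simp only [dotProduct, Finset.mul_sum, ← Finset.sum_add_distrib]
    refine Finset.sum_congr rfl fun j _ => ?_
    have h := congrFun hx j
    rw [Pmat_mulVec_apply, Pi.smul_apply, smul_eq_mul] at h
    have h0 := eC_ne_zero k (β (bI j))
    field_simp
    linear_combination -(y j) * h
  have h1 := key (y := w) hv
  have h2 := key (y := v) hw
  have hsymm : w ⬝ᵥ (Wd.map Complex.ofReal).mulVec v
      = v ⬝ᵥ (Wd.map Complex.ofReal).mulVec w := by
    rw [Matrix.dotProduct_mulVec, ← Matrix.mulVec_transpose, ← Matrix.transpose_map, hW.eq,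
      dotProduct_comm]
  rw [hsymm, dotProduct_comm] at h1
  simp only [mul_comm (w _)] at h2
  rw [← h2, ← sub_eq_zero, ← sub_mul] at h1
  exact (mul_eq_zero.1 h1).resolve_left (sub_ne_zero.2 hab)

/-- A limit of eigenvectors of `P_{ε,β}` whose eigenvalues tend to `e^{-2πikβ_s}` is supported
in the `s`-th band. -/
lemma limit_supported {k : ℤ} {β : Fin S → ℝ} {bI : Fin N → Fin S}
    {Wd : Matrix (Fin N) (Fin N) ℝ}
    (hdist : ∀ s1 s2 : Fin S, s1 ≠ s2 → eC k (β s1) ≠ eC k (β s2))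
    {F : Filter ℝ} [F.NeBot] (hF : F ≤ 𝓝[>] (0 : ℝ)) {f : ℝ → Fin N → ℂ} {a : ℝ → ℂ}
    {u : Fin N → ℂ} {s : Fin S}
    (heig : ∀ᶠ ε in F, (Pmat k β bI Wd ε).mulVec (f ε) = a ε • f ε)
    (ha : Tendsto a F (𝓝 (eC k (β s)))) (hf : Tendsto f F (𝓝 u)) {j : Fin N} (hj : bI j ≠ s) :
    u j = 0 := by
  have hε : Tendsto (fun ε : ℝ => (ε : ℂ)) F (𝓝 0) := by
    have : Tendsto (fun ε : ℝ => (ε : ℂ)) (𝓝 0) (𝓝 ((0 : ℝ) : ℂ)) :=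
      Complex.continuous_ofReal.tendsto 0
    simpa using this.mono_left (hF.trans nhdsWithin_le_nhds)
  have hWf : Tendsto (fun ε => (Wd.map Complex.ofReal).mulVec (f ε) j) F
      (𝓝 ((Wd.map Complex.ofReal).mulVec u j)) :=
    (((continuous_apply j).comp
      (Continuous.matrix_mulVec continuous_const continuous_id)).tendsto u).comp hf
  have hfj := tendsto_pi_nhds.1 hf j
  have h1 := (hfj.add (hε.mul hWf)).const_mul (eC k (β (bI j)))
  have h2 := ha.mul hfj
  have h3 := tendsto_nhds_unique_of_eventuallyEq h1 h2 (by
    filter_upwards [heig] with ε h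
    rw [← Pmat_mulVec_apply, h, Pi.smul_apply, smul_eq_mul])
  rw [zero_mul, add_zero, ← sub_eq_zero, ← sub_mul] at h3
  exact (mul_eq_zero.1 h3).resolve_left (sub_ne_zero.2 (hdist _ _ hj))

/-- A nonzero limit of eigenvectors of `P_{ε,β}` whose eigenvalues `a ε` tend to
`e^{-2πikβ_s}` is an eigenvector of `Ŵ_L`, whose eigenvalue is the limit of the rescaled
eigenvalues. -/
lemma limit_eigenvector {k : ℤ} {β : Fin S → ℝ} {bI : Fin N → Fin S}
    {Wd : Matrix (Fin N) (Fin N) ℝ}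
    {F : Filter ℝ} [F.NeBot] (hF : F ≤ 𝓝[>] (0 : ℝ)) {f : ℝ → Fin N → ℂ} {a : ℝ → ℂ}
    {u : Fin N → ℂ} {s : Fin S}
    (heig : ∀ᶠ ε in F, (Pmat k β bI Wd ε).mulVec (f ε) = a ε • f ε)
    (hf : Tendsto f F (𝓝 u)) (hsupp : ∀ j, bI j ≠ s → u j = 0) (hu : u ≠ 0) :
    ∃ ν : ℂ, Tendsto (fun ε : ℝ => (a ε - eC k (β s)) / (ε * eC k (β s))) F (𝓝 ν) ∧
      ((WhatL Wd bI).map Complex.ofReal).mulVec u = ν • u := by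
  have hWf : ∀ j, Tendsto (fun ε => (Wd.map Complex.ofReal).mulVec (f ε) j) F
      (𝓝 ((Wd.map Complex.ofReal).mulVec u j)) := fun j =>
    (((continuous_apply j).comp
      (Continuous.matrix_mulVec continuous_const continuous_id)).tendsto u).comp hf
  have hfj := tendsto_pi_nhds.1 hf
  have hpos : ∀ᶠ ε in F, (0 : ℝ) < ε := hF self_mem_nhdsWithin
  have hd := eC_ne_zero k (β s)
  have hν : ∀ j, bI j = s → ∀ᶠ ε in F,
      (a ε - eC k (β s)) / (ε * eC k (β s)) * f ε j = (Wd.map Complex.ofReal).mulVec (f ε) j := by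
    intro j hj
    filter_upwards [heig, hpos] with ε h hε
    have h' := congrFun h j
    rw [Pmat_mulVec_apply, Pi.smul_apply, smul_eq_mul, hj] at h'
    have hε' : (ε : ℂ) ≠ 0 := by exact_mod_cast hε.ne'
    field_simp
    linear_combination -h'
  obtain ⟨j₀, hj₀⟩ := Function.ne_iff.1 hu
  have hj₀s : bI j₀ = s := by
    by_contra h
    exact hj₀ (hsupp j₀ h)
  have hlim : Tendsto (fun ε : ℝ => (a ε - eC k (β s)) / (ε * eC k (β s))) F
      (𝓝 ((Wd.map Complex.ofReal).mulVec u j₀ / u j₀)) := by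
    refine ((hWf j₀).div (hfj j₀) hj₀).congr' ?_
    filter_upwards [hν j₀ hj₀s, (hfj j₀).eventually_ne hj₀] with ε h h0
    rw [Pi.div_apply, ← h, mul_div_cancel_right₀ _ h0]
  refine ⟨_, hlim, funext fun j => ?_⟩
  by_cases hj : bI j = s
  · rw [WhatL_mulVec_apply hsupp hj]
    exact (tendsto_nhds_unique_of_eventuallyEq (hlim.mul (hfj j)) (hWf j) (hν j hj)).symm
  · rw [WhatL_mulVec_apply_of_ne hsupp hj, Pi.smul_apply, hsupp j hj, smul_zero]

lemma card_band_le {L : Fin S → ℕ} {bI : Fin N → Fin S} (hbI : ∀ j, inBand L (bI j) j)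
    (s : Fin S) : Fintype.card {j // bI j = s} ≤ L s := by
  have hN : Nsum L (s + 1) = Nsum L s + L s := by
    have h : ∀ i : Fin S, (if (i : ℕ) < s + 1 then L i else 0)
        = (if (i : ℕ) < s then L i else 0) + if i = s then L i else 0 := by
      intro i
      simp only [Fin.ext_iff]
      split_ifs <;> omega
    simp only [Nsum, h, Finset.sum_add_distrib, Finset.sum_ite_eq', Finset.mem_univ, if_true]
  have hcard : (Finset.univ.filter fun j => bI j = s).card
      ≤ (Finset.Ico (Nsum L s) (Nsum L (s + 1))).card := by
    refine Finset.card_le_card_of_injOn Fin.val (fun j hj => ?_) Fin.val_injective.injOn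
    have hj' : bI j = s := by simpa using hj
    have := hbI j
    rw [hj'] at this
    simpa [inBand] using this
  rw [Fintype.card_subtype]
  simpa [hN] using hcard

/-- Eigenvectors of `Ŵ_L` supported in one band are multiples of the given real ones. -/
lemma eigenvector_eq_smul {L : Fin S → ℕ} {bI : Fin N → Fin S}
    (hbI : ∀ j, inBand L (bI j) j) {Wd : Matrix (Fin N) (Fin N) ℝ} {s : Fin S}
    {μ : Fin (L s) → ℝ} (hμ : Function.Injective μ) {v : Fin (L s) → Fin N → ℝ}
    (hv0 : ∀ i, v i ≠ 0) (hvs : ∀ i j, bI j ≠ s → v i j = 0)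
    (hv : ∀ i, (WhatL Wd bI).mulVec (v i) = μ i • v i)
    {u : Fin N → ℂ} {ν : ℂ} (hu0 : u ≠ 0) (hus : ∀ j, bI j ≠ s → u j = 0)
    (hu : ((WhatL Wd bI).map Complex.ofReal).mulVec u = ν • u) :
    ∃ i, ν = μ i ∧ ∃ c : ℂ, u = c • fun j => (v i j : ℂ) := by
  set A := (WhatL Wd bI).map Complex.ofReal with hA
  set V : Fin (L s) → Fin N → ℂ := fun i j => (v i j : ℂ) with hV
  have hAV : ∀ i, A.mulVec (V i) = (μ i : ℂ) • V i := by
    intro i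
    ext j
    have := congrArg Complex.ofReal (congrFun (hv i) j)
    simpa [hA, hV, Matrix.mulVec, dotProduct] using this
  have hV0 : ∀ i, V i ≠ 0 := by
    intro i h
    refine hv0 i (funext fun j => ?_)
    simpa [hV] using congrFun h j
  have hli : LinearIndependent ℂ V :=
    Module.End.eigenvectors_linearIndependent' (Matrix.toLin' A) (fun i => (μ i : ℂ))
      (Complex.ofReal_injective.comp hμ) V fun i =>
        Module.End.hasEigenvector_iff.2
          ⟨Module.End.mem_eigenspace_iff.2 (by rw [Matrix.toLin'_apply, hAV]), hV0 i⟩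
  let ext0 : ({j // bI j = s} → ℂ) →ₗ[ℂ] (Fin N → ℂ) :=
    Function.ExtendByZero.linearMap ℂ Subtype.val
  have hmem : ∀ x : Fin N → ℂ, (∀ j, bI j ≠ s → x j = 0) → x ∈ LinearMap.range ext0 := by
    intro x hx
    refine ⟨fun j => x j, funext fun j => ?_⟩
    by_cases hj : bI j = s
    · exact Subtype.val_injective.extend_apply (fun j : {j // bI j = s} => x j) 0 ⟨j, hj⟩
    · rw [hx j hj]
      exact Function.extend_apply' (f := Subtype.val) (fun j : {j // bI j = s} => x j)
        (0 : Fin N → ℂ) j fun ⟨a, ha⟩ => hj (ha ▸ a.2)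
  have hspan : Submodule.span ℂ (Set.range V) = LinearMap.range ext0 := by
    refine Submodule.eq_of_le_of_finrank_le ?_ ?_
    · rw [Submodule.span_le]
      rintro _ ⟨i, rfl⟩
      exact hmem _ fun j hj => by simp [hV, hvs i j hj]
    · rw [finrank_span_eq_card hli, Fintype.card_fin]
      refine (LinearMap.finrank_range_le ext0).trans ?_
      rw [Module.finrank_fintype_fun_eq_card]
      exact card_band_le hbI s
  have huspan : u ∈ Submodule.span ℂ (Set.range V) := hspan ▸ hmem u hus
  obtain ⟨c, rfl⟩ := (Submodule.mem_span_range_iff_exists_fun ℂ).1 huspan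
  have hc : ∀ i, (c i * (μ i - ν)) = 0 := by
    refine Fintype.linearIndependent_iff.1 hli _ ?_
    have h : A.mulVec (∑ i, c i • V i) = ∑ i, (c i * μ i) • V i := by
      rw [Matrix.mulVec_sum]
      refine Finset.sum_congr rfl fun i _ => ?_
      rw [Matrix.mulVec_smul, hAV, smul_smul]
    rw [hu, Finset.smul_sum] at h
    simp only [mul_sub, sub_smul, Finset.sum_sub_distrib, ← h, smul_smul, mul_comm ν, sub_self]
  obtain ⟨i, hi⟩ : ∃ i, c i ≠ 0 := by
    by_contra! h
    exact hu0 (by simp [h])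
  have hνi : ν = μ i := (sub_eq_zero.1 ((mul_eq_zero.1 (hc i)).resolve_left hi)).symm
  refine ⟨i, hνi, c i, Finset.sum_eq_single i (fun l _ hl => ?_) (by simp)⟩
  have : c l = 0 := (mul_eq_zero.1 (hc l)).resolve_right fun h =>
    hl (hμ (Complex.ofReal_injective ((sub_eq_zero.1 h).trans hνi)))
  rw [this, zero_smul]

/-- asymptotic orthogonality of the eigenvectors of `P_{ε,β}`. -/
theorem stmt11 (N S : ℕ) (hN : 1 ≤ N) (hS1 : 1 ≤ S) (hSN : S ≤ N) (k : ℤ)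
    (β : Fin S → ℝ) (hβ : Function.Injective β)
    (L : Fin S → ℕ) (hL : ∀ s, 0 < L s) (hsum : ∑ s, L s = N)
    (bI : Fin N → Fin S) (hbI : ∀ j, inBand L (bI j) j)
    (Wd : Matrix (Fin N) (Fin N) ℝ) (hadm : LAdmissible L Wd bI)
    (hdist : ∀ s1 s2 : Fin S, s1 ≠ s2 → eC k (β s1) ≠ eC k (β s2))
    (ε₀ : ℝ) (hε₀ : 0 < ε₀)
    (f : ℝ → Fin N → Fin N → ℂ) (lam : ℝ → Fin N → ℂ)
    (hbasis : ∀ ε ∈ Set.Ioo (0:ℝ) ε₀, LinearIndependent ℂ (f ε))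
    (hspan : ∀ ε ∈ Set.Ioo (0:ℝ) ε₀, Submodule.span ℂ (Set.range (f ε)) = ⊤)
    (hunit : ∀ ε ∈ Set.Ioo (0:ℝ) ε₀, ∀ ℓ, nrm (f ε ℓ) = 1)
    (heig : ∀ ε ∈ Set.Ioo (0:ℝ) ε₀, ∀ ℓ,
      (Pmat k β bI Wd ε).mulVec (f ε ℓ) = lam ε ℓ • f ε ℓ)
    (hlabel : ∀ ℓ, Tendsto (fun ε => lam ε ℓ) (𝓝[>] (0:ℝ)) (𝓝 (eC k (β (bI ℓ))))) :
    ∀ ℓ m : Fin N, ℓ ≠ m →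
      Tendsto (fun ε => inn (f ε ℓ) (f ε m)) (𝓝[>] (0:ℝ)) (𝓝 0) := by
  intro ℓ m hℓm
  obtain ⟨hsymm, -, -, -, hblock⟩ := hadm
  rw [tendsto_iff_ultrafilter]
  intro F hF
  have hIoo : ∀ᶠ ε in (F : Filter ℝ), ε ∈ Set.Ioo (0 : ℝ) ε₀ := hF (Ioo_mem_nhdsGT hε₀)
  have heigF : ∀ n, ∀ᶠ ε in (F : Filter ℝ),
      (Pmat k β bI Wd ε).mulVec (f ε n) = lam ε n • f ε n := fun n =>
    hIoo.mono fun ε h => heig ε h n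
  have hlim : ∀ n, ∃ u, nrm u = 1 ∧ Tendsto (fun ε => f ε n) F (𝓝 u) := fun n =>
    exists_tendsto_of_nrm_eq_one F _ (hIoo.mono fun ε h => hunit ε h n)
  have hne : ∀ x : Fin N → ℂ, nrm x = 1 → x ≠ 0 := by
    rintro x hx rfl
    simp [nrm_zero] at hx
  obtain ⟨u, hu1, hu⟩ := hlim ℓ
  obtain ⟨w, hw1, hw⟩ := hlim m
  have hus : ∀ j, bI j ≠ bI ℓ → u j = 0 := fun j hj =>
    limit_supported hdist hF (heigF ℓ) ((hlabel ℓ).mono_left hF) hu hj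
  have hws : ∀ j, bI j ≠ bI m → w j = 0 := fun j hj =>
    limit_supported hdist hF (heigF m) ((hlabel m).mono_left hF) hw hj
  suffices h : inn u w = 0 by
    rw [← h]
    exact tendsto_inn hu hw
  by_cases hb : bI m = bI ℓ
  swap
  · refine Finset.sum_eq_zero fun j _ => ?_
    by_cases hj : bI j = bI ℓ
    · rw [hws j (by rw [hj]; exact Ne.symm hb), map_zero, mul_zero]
    · rw [hus j hj, zero_mul]
  rw [hb] at hws
  obtain ⟨μ, hμ, v, hv0, hvs, hv⟩ := hblock (bI ℓ)
  by_cases heq : ∀ᶠ ε in (F : Filter ℝ), lam ε ℓ = lam ε m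
  · exfalso
    have hcomb : ∀ ε, ∃ g : Fin N → ℂ, ε ∈ Set.Ioo (0 : ℝ) ε₀ → lam ε ℓ = lam ε m →
        nrm g = 1 ∧ inn g (f ε ℓ) = 0 ∧ (Pmat k β bI Wd ε).mulVec g = lam ε ℓ • g := by
      intro ε
      by_cases hε : ε ∈ Set.Ioo (0 : ℝ) ε₀
      swap
      · exact ⟨0, fun h => absurd h hε⟩
      obtain ⟨a, b, h1, h2⟩ := exists_unit_combination_orthogonal (w := f ε m)
        (hunit ε hε ℓ) fun c hc => by
          have hpair := linearIndependent_iff'.1 (hbasis ε hε) Finset.univ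
            (Pi.single m 1 - Pi.single ℓ c) (by
              simp [sub_smul, Finset.sum_sub_distrib, Pi.single_apply, ite_smul, hc])
            m (Finset.mem_univ m)
          simp [hℓm.symm] at hpair
      refine ⟨_, fun _ hl => ⟨h1, h2, ?_⟩⟩
      rw [Matrix.mulVec_sub, Matrix.mulVec_smul, Matrix.mulVec_smul, heig ε hε, heig ε hε, ← hl,
        smul_sub, smul_comm a, smul_comm b]
    choose g hg using hcomb
    have hgF := hIoo.and heq
    obtain ⟨x, hx1, hx⟩ := exists_tendsto_of_nrm_eq_one F g
      (hgF.mono fun ε h => (hg ε h.1 h.2).1)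
    have hgeig := hgF.mono fun ε h => (hg ε h.1 h.2).2.2
    have hxs : ∀ j, bI j ≠ bI ℓ → x j = 0 := fun j hj =>
      limit_supported hdist hF hgeig ((hlabel ℓ).mono_left hF) hx hj
    have hxu : inn x u = 0 := tendsto_nhds_unique_of_eventuallyEq (tendsto_inn hx hu)
      tendsto_const_nhds (hgF.mono fun ε h => (hg ε h.1 h.2).2.1)
    obtain ⟨ν, hν, huν⟩ := limit_eigenvector hF (heigF ℓ) hu hus (hne u hu1)
    obtain ⟨ν', hν', hxν⟩ := limit_eigenvector hF hgeig hx hxs (hne x hx1)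
    obtain rfl := tendsto_nhds_unique hν hν'
    obtain ⟨i, hi, c, hc⟩ := eigenvector_eq_smul hbI hμ hv0 hvs hv (hne u hu1) hus huν
    obtain ⟨i', hi', c', hc'⟩ := eigenvector_eq_smul hbI hμ hv0 hvs hv (hne x hx1) hxs hxν
    obtain rfl := hμ (Complex.ofReal_injective (hi.symm.trans hi'))
    have hc0 : c ≠ 0 := by
      rintro rfl
      exact hne u hu1 (by simpa using hc)
    have hxcu : x = (c' / c) • u := by
      rw [hc', hc, smul_smul, div_mul_cancel₀ _ hc0]
    rw [hxcu, inn_smul_left, inn_self, hu1] at hxu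
    refine hne x hx1 ?_
    rw [hxcu]
    have : c' / c = 0 := by simpa using hxu
    rw [this, zero_smul]
  · rw [← Ultrafilter.eventually_not] at heq
    have hsum0 : ∑ j, (eC k (β (bI j)))⁻¹ * (u j * w j) = 0 := by
      have hu' := tendsto_pi_nhds.1 hu
      have hw' := tendsto_pi_nhds.1 hw
      refine tendsto_nhds_unique_of_eventuallyEq
        (tendsto_finsetSum Finset.univ fun j _ =>
          ((hu' j).mul (hw' j)).const_mul (eC k (β (bI j)))⁻¹) tendsto_const_nhds ?_
      filter_upwards [heigF ℓ, heigF m, heq] with ε h1 h2 h3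
      exact sum_inv_mul_mul_eq_zero hsymm h1 h2 h3
    have hfac : ∑ j, (eC k (β (bI j)))⁻¹ * (u j * w j)
        = (eC k (β (bI ℓ)))⁻¹ * ∑ j, u j * w j := by
      rw [Finset.mul_sum]
      refine Finset.sum_congr rfl fun j _ => ?_
      by_cases hj : bI j = bI ℓ
      · rw [hj]
      · simp [hus j hj]
    rw [hfac] at hsum0
    have hdot := (mul_eq_zero.1 hsum0).resolve_left (inv_ne_zero (eC_ne_zero _ _))
    obtain ⟨ν, -, hwν⟩ := limit_eigenvector hF (heigF m) hw hws (hne w hw1)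
    obtain ⟨i, -, c, hc⟩ := eigenvector_eq_smul hbI hμ hv0 hvs hv (hne w hw1) hws hwν
    have hc0 : c ≠ 0 := by
      rintro rfl
      exact hne w hw1 (by simpa using hc)
    have hreal : inn u (fun j => (v i j : ℂ)) = 0 := by
      have : c * inn u (fun j => (v i j : ℂ)) = ∑ j, u j * w j := by
        rw [hc, inn, Finset.mul_sum]
        refine Finset.sum_congr rfl fun j _ => ?_
        simp only [Complex.conj_ofReal, Pi.smul_apply, smul_eq_mul]
        ring
      rw [hdot] at this
      exact (mul_eq_zero.1 this).resolve_left hc0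
    rw [hc, inn_smul_right, hreal, mul_zero]
end
end
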